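/- Let n ≥ 5 and let d_0 and d_2 be the Chevalley–Eilenberg differentials of m0(n) and m2(n) respectively, acting on the exterior algebra Λ*(e^1,…,e^n) of the dual space. Then for every k ≥ 2 and every h ∈ Λ^k(e^1,…,e^n), f(d_2(h)) = d_0(f(h)); equivalently, the diagram intertwining d_0 and d_2 by f commutes. -/

import Mathlib

/-!
STATEMENT 5: Let n ≥ 5 and let d_0, d_2 be the Chevalley–Eilenberg differentials of
m0(n), m2(n) (derivations of Λ*(e^1,…,e^n) with d_0(e^1)=d_0(e^2)=0,
d_0(e^i)=e^1∧e^{i−1} for 3 ≤ i ≤ n; d_2(e^1)=d_2(e^2)=0, d_2(e^i)=e^1∧e^{i−1} for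
i = 3,4 and d_2(e^i)=e^1∧e^{i−1}+e^2∧e^{i−2} for 5 ≤ i ≤ n).  Then for every k ≥ 2
and every h ∈ Λ^k(e^1,…,e^n):  f(d_2(h)) = d_0(f(h)).
-/

noncomputable section
namespace Char2Filiform

/-- The exterior algebra Λ*(e^1,…,e^N). -/
abbrev XA (F : Type*) [Field F] (N : ℕ) := ExteriorAlgebra F (Fin N → F)

/-- The generator `e^{i+1}` (zero-indexed). -/
def gen (F : Type*) [Field F] (N : ℕ) (i : Fin N) : XA F N :=
  ExteriorAlgebra.ι F (Pi.single i (1 : F))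

/-- Derivation property (no signs since the base field has characteristic two). -/
def IsDeriv (F : Type*) [Field F] (N : ℕ) (D : XA F N →ₗ[F] XA F N) : Prop :=
  ∀ a b : XA F N, D (a * b) = D a * b + a * D b

/-- The subspace `Λ^k(e^1,…,e^N)` of forms of topological degree `k`. -/
def grade (F : Type*) [Field F] (N : ℕ) (k : ℕ) : Submodule F (XA F N) :=
  (LinearMap.range (ExteriorAlgebra.ι F (M := Fin N → F))) ^ k

/-- The subspace `Λ^k` spanned by the generators whose (zero-based) index lies in `s`. -/
def gradeOn (F : Type*) [Field F] (N : ℕ) (s : Set (Fin N)) (k : ℕ) :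
    Submodule F (XA F N) :=
  (Submodule.span F (gen F N '' s)) ^ k

/-- `D` is the derivation `D1`: `D1 e^1 = D1 e^2 = 0`, `D1 e^i = e^{i-1}` for `i ≥ 3`. -/
def IsD1 (F : Type*) [Field F] (N : ℕ) (D : XA F N →ₗ[F] XA F N) : Prop :=
  IsDeriv F N D ∧
  (∀ i : Fin N, (i : ℕ) ≤ 1 → D (gen F N i) = 0) ∧
  (∀ m : ℕ, (h : m + 3 ≤ N) → D (gen F N ⟨m + 2, by omega⟩) = gen F N ⟨m + 1, by omega⟩)

/-- `d` is the Chevalley–Eilenberg differential of `m0(N)`: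
`d e^1 = d e^2 = 0` and `d e^i = e^1 ∧ e^{i-1}` for `3 ≤ i ≤ N`. -/
def Isd0 (F : Type*) [Field F] (N : ℕ) (d : XA F N →ₗ[F] XA F N) : Prop :=
  IsDeriv F N d ∧
  (∀ i : Fin N, (i : ℕ) ≤ 1 → d (gen F N i) = 0) ∧
  (∀ m : ℕ, (h : m + 3 ≤ N) →
    d (gen F N ⟨m + 2, by omega⟩) = gen F N ⟨0, by omega⟩ * gen F N ⟨m + 1, by omega⟩)

/-- `d` is the Chevalley–Eilenberg differential of `m2(N)`:
`d e^1 = d e^2 = 0`, `d e^i = e^1 ∧ e^{i-1}` for `i = 3,4`, and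
`d e^i = e^1 ∧ e^{i-1} + e^2 ∧ e^{i-2}` for `5 ≤ i ≤ N`. -/
def Isd2 (F : Type*) [Field F] (N : ℕ) (d : XA F N →ₗ[F] XA F N) : Prop :=
  IsDeriv F N d ∧
  (∀ i : Fin N, (i : ℕ) ≤ 1 → d (gen F N i) = 0) ∧
  (∀ m : ℕ, (h : m + 3 ≤ N) → m ≤ 1 →
    d (gen F N ⟨m + 2, by omega⟩) = gen F N ⟨0, by omega⟩ * gen F N ⟨m + 1, by omega⟩) ∧
  (∀ m : ℕ, (h : m + 5 ≤ N) →
    d (gen F N ⟨m + 4, by omega⟩) =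
      gen F N ⟨0, by omega⟩ * gen F N ⟨m + 3, by omega⟩ +
      gen F N ⟨1, by omega⟩ * gen F N ⟨m + 2, by omega⟩)

/-- `f` is the linear map with
`f(e^1∧x + e^2∧y + z) = e^1∧x + e^2∧(y + D1 x) + z` for
`x ∈ Λ^{k-1}(e^2,…,e^N)`, `y ∈ Λ^{k-1}(e^3,…,e^N)`, `z ∈ Λ^k(e^3,…,e^N)`, `k ≥ 2`. -/
def IsF (F : Type*) [Field F] (N : ℕ) (hN : 2 ≤ N)
    (D1 f : XA F N →ₗ[F] XA F N) : Prop :=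
  ∀ k : ℕ, 2 ≤ k →
    ∀ x ∈ gradeOn F N {i : Fin N | 1 ≤ (i : ℕ)} (k - 1),
    ∀ y ∈ gradeOn F N {i : Fin N | 2 ≤ (i : ℕ)} (k - 1),
    ∀ z ∈ gradeOn F N {i : Fin N | 2 ≤ (i : ℕ)} k,
      f (gen F N ⟨0, by omega⟩ * x + gen F N ⟨1, by omega⟩ * y + z)
        = gen F N ⟨0, by omega⟩ * x + gen F N ⟨1, by omega⟩ * (y + D1 x) + z

/-- The exterior algebra over a field of characteristic two is commutative. -/
lemma mul_comm_of_charTwo (F : Type*) [Field F] [CharP F 2] (N : ℕ) (a b : XA F N) :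
    a * b = b * a := by
  have hneg (u : XA F N) : -u = u := by
    rw [← neg_one_smul F u, CharTwo.neg_eq, one_smul]
  have hι (v w : Fin N → F) : ExteriorAlgebra.ι F v * ExteriorAlgebra.ι F w =
      ExteriorAlgebra.ι F w * ExteriorAlgebra.ι F v := by
    rw [eq_neg_of_add_eq_zero_left (ExteriorAlgebra.ι_add_mul_swap v w), hneg]
  induction a using ExteriorAlgebra.induction with
  | algebraMap r => exact Algebra.commutes r b
  | ι v =>
    induction b using ExteriorAlgebra.induction with
    | algebraMap r => exact (Algebra.commutes r _).symm
    | ι w => exact hι v w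
    | mul c d hc hd => rw [← mul_assoc, hc, mul_assoc, hd, mul_assoc]
    | add c d hc hd => rw [mul_add, add_mul, hc, hd]
  | mul c d hc hd => rw [mul_assoc, hd, ← mul_assoc, hc, mul_assoc]
  | add c d hc hd => rw [mul_add, add_mul, hc, hd]

lemma add_self_of_charTwo (F : Type*) [Field F] [CharP F 2] (N : ℕ) (a : XA F N) :
    a + a = 0 := by
  rw [← two_smul F a, CharTwo.two_eq_zero, zero_smul]

lemma gen_mul_self (F : Type*) [Field F] (N : ℕ) (i : Fin N) :
    gen F N i * gen F N i = 0 :=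
  ExteriorAlgebra.ι_sq_zero _

lemma span_range_gen (F : Type*) [Field F] (N : ℕ) :
    Submodule.span F (Set.range (gen F N)) =
      LinearMap.range (ExteriorAlgebra.ι F (M := Fin N → F)) := by
  have h : Set.range (gen F N) =
      ExteriorAlgebra.ι F '' Set.range (fun i : Fin N => Pi.single i (1 : F)) := by
    rw [← Set.range_comp]; rfl
  have hb : Submodule.span F (Set.range (fun i : Fin N => Pi.single i (1 : F))) = ⊤ := by
    convert (Pi.basisFun F (Fin N)).span_eq using 3
    ext i : 1
    simp
  rw [h, ← Submodule.map_span, hb, Submodule.map_top]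

/-- Derivations of the exterior algebra are determined by their values on the generators. -/
lemma IsDeriv.ext_gen {F : Type*} [Field F] {N : ℕ} {D E : XA F N →ₗ[F] XA F N}
    (hD : IsDeriv F N D) (hE : IsDeriv F N E) (h : ∀ i, D (gen F N i) = E (gen F N i)) :
    D = E := by
  have one {G : XA F N →ₗ[F] XA F N} (hG : IsDeriv F N G) : G 1 = 0 := by
    simpa using hG 1 1
  refine LinearMap.ext fun a => ?_
  induction a using ExteriorAlgebra.induction with
  | algebraMap r => rw [Algebra.algebraMap_eq_smul_one, map_smul, map_smul, one hD, one hE]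
  | ι v =>
    have hv : ExteriorAlgebra.ι F v ∈ Submodule.span F (Set.range (gen F N)) := by
      rw [span_range_gen]; exact ⟨v, rfl⟩
    refine LinearMap.eqOn_span ?_ hv
    rintro _ ⟨i, rfl⟩
    exact h i
  | mul c d hc hd => rw [hD, hE, hc, hd]
  | add c d hc hd => rw [map_add, map_add, hc, hd]

/-- A derivation preserving a subspace preserves all of its powers. -/
lemma IsDeriv.apply_mem_pow {F : Type*} [Field F] {N : ℕ} {D : XA F N →ₗ[F] XA F N}
    (hD : IsDeriv F N D) {A : Submodule F (XA F N)} (hA : ∀ a ∈ A, D a ∈ A) (k : ℕ) :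
    ∀ a ∈ A ^ k, D a ∈ A ^ k := by
  induction k with
  | zero =>
    intro a ha
    rw [pow_zero, Submodule.mem_one] at ha
    obtain ⟨r, rfl⟩ := ha
    have h1 : D 1 = 0 := by simpa using hD 1 1
    rw [Algebra.algebraMap_eq_smul_one, map_smul, h1, smul_zero]
    exact zero_mem _
  | succ k ih =>
    intro a ha
    rw [pow_succ] at ha ⊢
    induction ha using Submodule.mul_induction_on' with
    | mem_mul_mem b hb c hc =>
      rw [hD]
      exact add_mem (Submodule.mul_mem_mul (ih b hb) hc) (Submodule.mul_mem_mul hb (hA c hc))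
    | add b _ c _ hb hc => rw [map_add]; exact add_mem hb hc

lemma IsDeriv.mulLeft_comp {F : Type*} [Field F] [CharP F 2] {N : ℕ}
    {D : XA F N →ₗ[F] XA F N} (hD : IsDeriv F N D) (u : XA F N) :
    IsDeriv F N (LinearMap.mulLeft F u ∘ₗ D) := by
  intro a b
  simp only [LinearMap.comp_apply, LinearMap.mulLeft_apply]
  rw [hD, mul_add, ← mul_assoc, ← mul_assoc, mul_comm_of_charTwo F N u a, mul_assoc a]

/-- In characteristic two the square of a derivation is a derivation. -/
lemma IsDeriv.comp_self {F : Type*} [Field F] [CharP F 2] {N : ℕ}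
    {D : XA F N →ₗ[F] XA F N} (hD : IsDeriv F N D) : IsDeriv F N (D ∘ₗ D) := by
  intro a b
  simp only [LinearMap.comp_apply]
  rw [hD, map_add, hD, hD, add_assoc, ← add_assoc (D a * D b), add_self_of_charTwo, zero_add]

lemma IsDeriv.add {F : Type*} [Field F] {N : ℕ} {D E : XA F N →ₗ[F] XA F N}
    (hD : IsDeriv F N D) (hE : IsDeriv F N E) : IsDeriv F N (D + E) := by
  intro a b
  simp only [LinearMap.add_apply]
  rw [hD, hE, add_mul, mul_add]
  abel

lemma mem_gradeOn_insert {F : Type*} [Field F] [CharP F 2] {N : ℕ} (i : Fin N)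
    (s : Set (Fin N)) (k : ℕ) :
    ∀ h ∈ gradeOn F N (insert i s) (k + 1),
      ∃ x ∈ gradeOn F N s k, ∃ w ∈ gradeOn F N s (k + 1), h = gen F N i * x + w := by
  have key : ∀ u ∈ Submodule.span F (gen F N '' insert i s),
      ∃ r : F, ∃ v ∈ Submodule.span F (gen F N '' s), u = r • gen F N i + v := by
    intro u hu
    rw [Set.image_insert_eq] at hu
    exact Submodule.mem_span_insert.mp hu
  induction k with
  | zero =>
    intro h hh
    simp only [gradeOn, zero_add, pow_one, pow_zero] at hh ⊢
    obtain ⟨r, v, hv, rfl⟩ := key h hh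
    refine ⟨algebraMap F _ r, Submodule.mem_one.mpr ⟨r, rfl⟩, v, hv, ?_⟩
    rw [Algebra.algebraMap_eq_smul_one, mul_smul_comm, mul_one]
  | succ k ih =>
    intro h hh
    rw [gradeOn, pow_succ'] at hh
    induction hh using Submodule.mul_induction_on' with
    | mem_mul_mem u hu c hc =>
      obtain ⟨r, v, hv, rfl⟩ := key u hu
      obtain ⟨x, hx, w, hw, rfl⟩ := ih c hc
      have hvx : v * x ∈ gradeOn F N s (k + 1) := by
        rw [gradeOn, pow_succ']; exact Submodule.mul_mem_mul hv hx
      have hvw : v * w ∈ gradeOn F N s (k + 1 + 1) := by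
        rw [gradeOn, pow_succ']; exact Submodule.mul_mem_mul hv hw
      refine ⟨r • w + v * x, add_mem (Submodule.smul_mem _ r hw) hvx, v * w, hvw, ?_⟩
      have e₁ : gen F N i * (gen F N i * x) = 0 := by
        rw [← mul_assoc, gen_mul_self, zero_mul]
      have e₂ : v * (gen F N i * x) = gen F N i * (v * x) := by
        rw [← mul_assoc, mul_comm_of_charTwo F N v, mul_assoc]
      simp only [add_mul, mul_add, smul_mul_assoc, mul_smul_comm, e₁, e₂, smul_zero]
      abel
    | add b _ c _ hb hc =>
      obtain ⟨x, hx, w, hw, rfl⟩ := hb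
      obtain ⟨x', hx', w', hw', rfl⟩ := hc
      refine ⟨x + x', add_mem hx hx', w + w', add_mem hw hw', ?_⟩
      rw [mul_add]
      abel

lemma IsD1.apply_mem_gradeOn {F : Type*} [Field F] {N : ℕ} {D1 : XA F N →ₗ[F] XA F N}
    (hD1 : IsD1 F N D1) (k : ℕ) :
    ∀ a ∈ gradeOn F N {i : Fin N | 1 ≤ (i : ℕ)} k,
      D1 a ∈ gradeOn F N {i : Fin N | 1 ≤ (i : ℕ)} k := by
  refine hD1.1.apply_mem_pow (fun a ha => ?_) k
  induction ha using Submodule.span_induction with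
  | mem a ha =>
    obtain ⟨⟨i, hi⟩, -, rfl⟩ := ha
    by_cases h : i ≤ 1
    · rw [hD1.2.1 ⟨i, hi⟩ h]; exact zero_mem _
    · obtain ⟨m, rfl⟩ : ∃ m, i = m + 2 := ⟨i - 2, by omega⟩
      rw [hD1.2.2 m (by omega)]
      exact Submodule.subset_span ⟨_, by simp, rfl⟩
  | zero => rw [map_zero]; exact zero_mem _
  | add a b _ _ ha hb => rw [map_add]; exact add_mem ha hb
  | smul r a _ ha => rw [map_smul]; exact Submodule.smul_mem _ r ha

/-- `d_0 = e^1 ∧ D1`. -/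
lemma Isd0.apply_eq {F : Type*} [Field F] [CharP F 2] {N : ℕ} (hN : 0 < N)
    {D1 d0 : XA F N →ₗ[F] XA F N} (hD1 : IsD1 F N D1) (hd0 : Isd0 F N d0) (a : XA F N) :
    d0 a = gen F N ⟨0, hN⟩ * D1 a := by
  have h : d0 = LinearMap.mulLeft F (gen F N ⟨0, hN⟩) ∘ₗ D1 := by
    refine hd0.1.ext_gen (hD1.1.mulLeft_comp _) fun ⟨i, hi⟩ => ?_
    rw [LinearMap.comp_apply, LinearMap.mulLeft_apply]
    by_cases h : i ≤ 1
    · rw [hd0.2.1 ⟨i, hi⟩ h, hD1.2.1 ⟨i, hi⟩ h, mul_zero]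
    · obtain ⟨m, rfl⟩ : ∃ m, i = m + 2 := ⟨i - 2, by omega⟩
      rw [hd0.2.2 m (by omega), hD1.2.2 m (by omega)]
  rw [h, LinearMap.comp_apply, LinearMap.mulLeft_apply]

/-- `d_2 = e^1 ∧ D1 + e^2 ∧ D1²`. -/
lemma Isd2.apply_eq {F : Type*} [Field F] [CharP F 2] {N : ℕ} (hN : 1 < N)
    {D1 d2 : XA F N →ₗ[F] XA F N} (hD1 : IsD1 F N D1) (hd2 : Isd2 F N d2) (a : XA F N) :
    d2 a = gen F N ⟨0, by omega⟩ * D1 a + gen F N ⟨1, hN⟩ * D1 (D1 a) := by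
  have h : d2 = LinearMap.mulLeft F (gen F N ⟨0, by omega⟩) ∘ₗ D1 +
      LinearMap.mulLeft F (gen F N ⟨1, hN⟩) ∘ₗ (D1 ∘ₗ D1) := by
    refine hd2.1.ext_gen ((hD1.1.mulLeft_comp _).add (hD1.1.comp_self.mulLeft_comp _))
      fun ⟨i, hi⟩ => ?_
    simp only [LinearMap.add_apply, LinearMap.comp_apply, LinearMap.mulLeft_apply]
    match i, hi with
    | 0, hi | 1, hi => rw [hd2.2.1 _ (by simp), hD1.2.1 _ (by simp)]; simp
    | 2, hi =>
      rw [hd2.2.2.1 0 (by omega) (by omega), hD1.2.2 0 (by omega),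
        hD1.2.1 ⟨0 + 1, _⟩ (by simp), mul_zero, add_zero]
    | 3, hi =>
      rw [hd2.2.2.1 1 (by omega) (by omega), hD1.2.2 1 (by omega), hD1.2.2 0 (by omega)]
      simp only [zero_add, gen_mul_self, add_zero]
    | m + 4, hi =>
      rw [hd2.2.2.2 m (by omega), hD1.2.2 (m + 2) (by omega), hD1.2.2 (m + 1) (by omega)]
  rw [h]
  rfl

/-- The formula for `f` with the `e^2`-component left inside `w ∈ Λ^k(e^2,…,e^N)`. -/
lemma IsF.apply_gen_mul_add {F : Type*} [Field F] [CharP F 2] {N : ℕ} {hN : 2 ≤ N}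
    {D1 f : XA F N →ₗ[F] XA F N} (hf : IsF F N hN D1 f) {k : ℕ} (hk : 1 ≤ k) {x w : XA F N}
    (hx : x ∈ gradeOn F N {i : Fin N | 1 ≤ (i : ℕ)} k)
    (hw : w ∈ gradeOn F N {i : Fin N | 1 ≤ (i : ℕ)} (k + 1)) :
    f (gen F N ⟨0, by omega⟩ * x + w) =
      gen F N ⟨0, by omega⟩ * x + w + gen F N ⟨1, by omega⟩ * D1 x := by
  have hs : {i : Fin N | 1 ≤ (i : ℕ)} =
      insert (⟨1, by omega⟩ : Fin N) {i : Fin N | 2 ≤ (i : ℕ)} := by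
    ext i
    simp only [Set.mem_ofPred_eq, Set.mem_insert_iff, Fin.ext_iff]
    omega
  obtain ⟨y, hy, z, hz, rfl⟩ := mem_gradeOn_insert _ _ _ w (hs ▸ hw)
  rw [← add_assoc, hf (k + 1) (by omega) x hx y hy z hz, mul_add]
  abel

lemma grade_eq_gradeOn_insert (F : Type*) [Field F] {N : ℕ} (hN : 0 < N) (k : ℕ) :
    grade F N k = gradeOn F N (insert (⟨0, hN⟩ : Fin N) {i : Fin N | 1 ≤ (i : ℕ)}) k := by
  have hs : insert (⟨0, hN⟩ : Fin N) {i : Fin N | 1 ≤ (i : ℕ)} = Set.univ := by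
    ext i
    simp only [Set.mem_ofPred_eq, Set.mem_insert_iff, Fin.ext_iff, Set.mem_univ, iff_true]
    omega
  rw [hs, grade, gradeOn, Set.image_univ, span_range_gen]

theorem f_intertwines_d0_d2 (F : Type*) [Field F] [CharP F 2] (n : ℕ) (hn : 5 ≤ n)
    (D1 f d0 d2 : XA F n →ₗ[F] XA F n)
    (hD1 : IsD1 F n D1) (hf : IsF F n (by omega) D1 f)
    (hd0 : Isd0 F n d0) (hd2 : Isd2 F n d2) :
    ∀ k : ℕ, 2 ≤ k → ∀ h ∈ grade F n k, f (d2 h) = d0 (f h) := by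
  intro k hk h hh
  obtain ⟨m, rfl⟩ : ∃ m, k = m + 1 := ⟨k - 1, by omega⟩
  rw [grade_eq_gradeOn_insert F (by omega : 0 < n)] at hh
  obtain ⟨x, hx, w, hw, rfl⟩ := mem_gradeOn_insert _ _ _ h hh
  have hfh := hf.apply_gen_mul_add (by omega) hx hw
  set e₁ := gen F n ⟨0, by omega⟩ with he₁
  set e₂ := gen F n ⟨1, by omega⟩ with he₂
  have hD := hD1.apply_mem_gradeOn
  have he₂_mul {j : ℕ} {a : XA F n} (ha : a ∈ gradeOn F n {i : Fin n | 1 ≤ (i : ℕ)} j) :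
      e₂ * a ∈ gradeOn F n {i : Fin n | 1 ≤ (i : ℕ)} (j + 1) := by
    rw [gradeOn, pow_succ']
    exact Submodule.mul_mem_mul (Submodule.subset_span ⟨_, by simp, rfl⟩) ha
  have D_e₁ (a : XA F n) : D1 (e₁ * a) = e₁ * D1 a := by
    rw [hD1.1, hD1.2.1 _ (by simp), zero_mul, zero_add]
  have D_e₂ (a : XA F n) : D1 (e₂ * a) = e₂ * D1 a := by
    rw [hD1.1, hD1.2.1 _ (by simp), zero_mul, zero_add]
  have e₁_e₁ (a : XA F n) : e₁ * (e₁ * a) = 0 := by rw [← mul_assoc, gen_mul_self, zero_mul]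
  have e₂_e₂ (a : XA F n) : e₂ * (e₂ * a) = 0 := by rw [← mul_assoc, gen_mul_self, zero_mul]
  have e₂_e₁ (a : XA F n) : e₂ * (e₁ * a) = e₁ * (e₂ * a) := by
    rw [← mul_assoc, mul_comm_of_charTwo F n e₂, mul_assoc]
  have hd2h : d2 (e₁ * x + w) = e₁ * (e₂ * D1 (D1 x) + D1 w) + e₂ * D1 (D1 w) := by
    rw [hd2.apply_eq (by omega) hD1, ← he₁, ← he₂]
    simp only [map_add, D_e₁, mul_add, e₁_e₁, e₂_e₁]
    abel
  have hfd := hf.apply_gen_mul_add (k := m + 1) (by omega)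
    (add_mem (he₂_mul (hD _ _ (hD _ _ hx))) (hD _ _ hw)) (he₂_mul (hD _ _ (hD _ _ hw)))
  rw [← he₁, ← he₂] at hfd
  rw [hd2h, hfd, hfh, hd0.apply_eq (by omega) hD1, ← he₁]
  simp only [map_add, D_e₁, D_e₂, mul_add, e₁_e₁, e₂_e₂, zero_add, add_assoc,
    add_self_of_charTwo, add_zero]
  abel

end Char2Filiform
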